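/- arXiv:math/9604214 — 4 statements merged into one kernel-verified Lean document; each statement's English description precedes it below -/
import Mathlib

section
/- Let 2 < p < ∞, let (w_m) be a sequence in (0,1], let (z_m) be the standard unit vector basis of X_{p,(w_m)} (so ‖z_m‖ = 1 and ‖z_m‖_2 = w_m for each m), and let T be a bounded linear operator from X_{p,(w_m)} into L_p(ν) (ν a probability measure) that is an isomorphism onto its range. If B = { m ∈ ℕ : ‖T z_m‖_{L_2(ν)} > ‖T‖ · w_m }, then ∑_{m∈B} w_m^{2p/(p-2)} ≤ 1. -/
open MeasureTheory Finset

/-- The `L_r(ν)` norm of a real-valued function. -/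
noncomputable def lpN {Ω : Type*} [MeasurableSpace Ω] (ν : Measure Ω) (r : ℝ) (f : Ω → ℝ) : ℝ :=
  (∫ x, |f x| ^ r ∂ν) ^ (1 / r)

/-- The norm of the sequence space `X_{p,(w_n)}`. -/
noncomputable def XpNorm (p : ℝ) (w : ℕ → ℝ) (a : ℕ → ℝ) : ℝ :=
  max ((∑' n, |a n| ^ p) ^ (1 / p)) ((∑' n, a n ^ 2 * w n ^ 2) ^ (1 / 2 : ℝ))

theorem XpNorm_pos {p : ℝ} (hp : 2 < p) (w : ℕ → ℝ) {a : ℕ →₀ ℝ} (ha : a ≠ 0) :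
    0 < XpNorm p w a := by
  obtain ⟨n, hn⟩ := Finsupp.ne_iff.1 ha
  have hs : Summable fun n => |a n| ^ p := by
    refine summable_of_ne_finset_zero (s := a.support) fun m hm => ?_
    rw [Finsupp.notMem_support_iff.1 hm, abs_zero, Real.zero_rpow (by linarith)]
  have hpos : 0 < ∑' n, |a n| ^ p :=
    hs.tsum_pos (fun m => by positivity) n (Real.rpow_pos_of_pos (abs_pos.2 hn) p)
  exact lt_max_of_lt_left (Real.rpow_pos_of_pos hpos _)

/-- Squares are integrable, and Jensen's inequality holds, as soon as `|f| ^ p` is integrable;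
`f` itself need not be measurable. -/
theorem integrable_sq_and_integral_sq_le {Ω : Type*} [MeasurableSpace Ω] {ν : Measure Ω}
    [IsProbabilityMeasure ν] {p : ℝ} (hp : 2 < p) {f : Ω → ℝ}
    (hf : Integrable (fun x => |f x| ^ p) ν) :
    Integrable (fun x => f x ^ 2) ν ∧ ∫ x, f x ^ 2 ∂ν ≤ lpN ν p f ^ 2 := by
  have hp0 : 0 < p := by linarith
  have hpow : ∀ x, (f x ^ 2) ^ (p / 2) = |f x| ^ p := fun x => by
    rw [← sq_abs, ← Real.rpow_natCast, ← Real.rpow_mul (abs_nonneg _)]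
    congr 1
    push_cast
    ring
  have hroot : ∀ x, (|f x| ^ p) ^ (2 / p) = f x ^ 2 := fun x => by
    rw [← hpow, ← Real.rpow_mul (sq_nonneg _)]
    rw [show p / 2 * (2 / p) = 1 by field_simp, Real.rpow_one]
  have hmeas : AEStronglyMeasurable (fun x => f x ^ 2) ν := by
    simp_rw [← hroot]
    exact (hf.aemeasurable.pow_const _).aestronglyMeasurable
  have hint : Integrable (fun x => f x ^ 2) ν := by
    refine (hf.add (integrable_const 1)).mono' hmeas (Filter.Eventually.of_forall fun x => ?_)
    rw [Real.norm_of_nonneg (sq_nonneg _), ← sq_abs]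
    change |f x| ^ 2 ≤ |f x| ^ p + 1
    rcases le_total |f x| 1 with h | h
    · have h1 := pow_le_one₀ (n := 2) (abs_nonneg (f x)) h
      have h2 : 0 ≤ |f x| ^ p := by positivity
      linarith
    · have h1 := Real.rpow_le_rpow_of_exponent_le h hp.le
      rw [Real.rpow_two] at h1
      linarith
  refine ⟨hint, ?_⟩
  have hjensen : (∫ x, f x ^ 2 ∂ν) ^ (p / 2) ≤ ∫ x, |f x| ^ p ∂ν := by
    have := (convexOn_rpow (p := p / 2) (by linarith)).map_integral_le (μ := ν)
      (f := fun x => f x ^ 2)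
      (Real.continuous_rpow_const (by linarith)).continuousOn isClosed_Ici
      (Filter.Eventually.of_forall fun x => Set.mem_Ici.2 (sq_nonneg _)) hint
      (by simpa only [Function.comp_def, hpow] using hf)
    simpa only [hpow] using this
  have h0 : 0 ≤ ∫ x, f x ^ 2 ∂ν := integral_nonneg fun x => sq_nonneg _
  have hI : 0 ≤ ∫ x, |f x| ^ p ∂ν := integral_nonneg fun x => by positivity
  calc ∫ x, f x ^ 2 ∂ν = ((∫ x, f x ^ 2 ∂ν) ^ (p / 2)) ^ (2 / p) := by
        rw [← Real.rpow_mul h0, show p / 2 * (2 / p) = 1 by field_simp, Real.rpow_one]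
    _ ≤ (∫ x, |f x| ^ p ∂ν) ^ (2 / p) := by gcongr
    _ = lpN ν p f ^ 2 := by
        rw [lpN, ← Real.rpow_natCast, ← Real.rpow_mul hI]
        congr 1
        push_cast
        ring

theorem lpN_two_sq {Ω : Type*} [MeasurableSpace Ω] (ν : Measure Ω) (f : Ω → ℝ) :
    lpN ν 2 f ^ 2 = ∫ x, f x ^ 2 ∂ν := by
  have h0 : 0 ≤ ∫ x, f x ^ 2 ∂ν := integral_nonneg fun x => sq_nonneg _
  simp only [lpN, Real.rpow_two, sq_abs]
  rw [← Real.sqrt_eq_rpow, Real.sq_sqrt h0]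

/-- A functional satisfying the parallelogram identity is, for a suitable choice of signs,
superadditive on a finite combination of unit vectors. -/
theorem exists_signs_sum_le {Q : (ℕ →₀ ℝ) → ℝ}
    (hQ : ∀ a b, Q (a + b) + Q (a - b) = 2 * Q a + 2 * Q b) (a : ℕ → ℝ) (F : Finset ℕ) :
    ∃ b : ℕ →₀ ℝ, (∀ m ∈ F, |b m| = |a m|) ∧ (∀ m ∉ F, b m = 0) ∧
      ∑ m ∈ F, Q (Finsupp.single m (a m)) ≤ Q b := by
  induction F using Finset.induction_on with
  | empty =>
    have := hQ 0 0
    simp only [add_zero, sub_zero] at this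
    exact ⟨0, by simp, by simp, by simp; linarith⟩
  | insert n F hn ih =>
    obtain ⟨b, hb, hb0, hle⟩ := ih
    have hpar := hQ b (Finsupp.single n (a n))
    have hne : ∀ m ∈ F, n ≠ m := fun m hm h => hn (h ▸ hm)
    rw [Finset.sum_insert hn]
    rcases le_total (Q (b + Finsupp.single n (a n))) (Q (b - Finsupp.single n (a n))) with h | h
    · refine ⟨b - Finsupp.single n (a n), fun m hm => ?_, fun m hm => ?_, by linarith⟩
      · rcases Finset.mem_insert.1 hm with rfl | hm
        · simp [hb0 m hn]
        · simp [Finsupp.single_eq_of_ne' (hne m hm), hb m hm]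
      · rw [Finset.mem_insert, not_or] at hm
        simp [hb0 m hm.2, Finsupp.single_eq_of_ne hm.1]
    · refine ⟨b + Finsupp.single n (a n), fun m hm => ?_, fun m hm => ?_, by linarith⟩
      · rcases Finset.mem_insert.1 hm with rfl | hm
        · simp [hb0 m hn]
        · simp [Finsupp.single_eq_of_ne' (hne m hm), hb m hm]
      · rw [Finset.mem_insert, not_or] at hm
        simp [hb0 m hm.2, Finsupp.single_eq_of_ne hm.1]

/-- Lemma 4.1: if `T` is an isomorphic embedding of `X_p` into `L_p` with `‖T‖ ≤ C`, and
`B = {m : ‖T z_m‖_2 > ‖T‖ ‖z_m‖_2}` (for the standard basis `(z_m)`), then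
`∑_{m ∈ B} w_m^{2p/(p-2)} ≤ 1`. -/
theorem operator_two_norm_control
    (p : ℝ) (hp : 2 < p) (w : ℕ → ℝ) (hw : ∀ n, 0 < w n ∧ w n ≤ 1)
    (Ω : Type*) [MeasurableSpace Ω] (ν : Measure Ω) [IsProbabilityMeasure ν]
    (T : (ℕ →₀ ℝ) →ₗ[ℝ] (Ω → ℝ)) (C : ℝ)
    -- `C` plays the role of `‖T‖`: it is an upper bound for `T` on `X_{p,(w_n)}`
    (hC : ∀ a : ℕ →₀ ℝ, lpN ν p (T a) ≤ C * XpNorm p w a)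
    -- `T` is an isomorphism onto its range
    (hiso : ∃ c : ℝ, 0 < c ∧ ∀ a : ℕ →₀ ℝ, c * XpNorm p w a ≤ lpN ν p (T a)) :
    ∀ F : Finset ℕ,
      (∀ m ∈ F, C * w m < lpN ν 2 (T (Finsupp.single m 1))) →
      ∑ m ∈ F, w m ^ (2 * p / (p - 2)) ≤ 1 := by
  intro F hF
  by_contra! hS
  obtain ⟨c, hc, hlow⟩ := hiso
  have hp0 : 0 < p := by linarith
  have hp2 : p - 2 ≠ 0 := by linarith
  have hint : ∀ a, Integrable (fun x => |T a x| ^ p) ν := fun a => by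
    rcases eq_or_ne a 0 with rfl | ha
    · simp [Real.zero_rpow hp0.ne']
    · by_contra h
      have hzero : lpN ν p (T a) = 0 := by
        rw [lpN, integral_undef h, Real.zero_rpow (by positivity)]
      have := hlow a
      have := mul_pos hc (XpNorm_pos hp w ha)
      linarith
  have hsq := fun a => (integrable_sq_and_integral_sq_le hp (hint a)).1
  have hpar : ∀ a b, ∫ x, T (a + b) x ^ 2 ∂ν + ∫ x, T (a - b) x ^ 2 ∂ν =
      2 * ∫ x, T a x ^ 2 ∂ν + 2 * ∫ x, T b x ^ 2 ∂ν := fun a b => by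
    rw [← integral_add (hsq _) (hsq _), ← integral_const_mul, ← integral_const_mul,
      ← integral_add ((hsq a).const_mul 2) ((hsq b).const_mul 2)]
    congr 1 with x
    simp only [map_add, map_sub, Pi.add_apply, Pi.sub_apply]
    ring
  have hCpos : 0 < C := by
    have hz : Finsupp.single 0 (1 : ℝ) ≠ (0 : ℕ →₀ ℝ) := by simp
    have hX := XpNorm_pos hp w hz
    exact pos_of_mul_pos_left
      (((mul_pos hc hX).trans_le (hlow _)).trans_le (hC _)) hX.le
  obtain ⟨b, hb, hb0, hle⟩ :=
    exists_signs_sum_le (Q := fun a => ∫ x, T a x ^ 2 ∂ν) hpar (fun m => w m ^ (2 / (p - 2))) F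
  have habs : ∀ m ∈ F, |b m| = w m ^ (2 / (p - 2)) := fun m hm => by
    rw [hb m hm, abs_of_nonneg (Real.rpow_nonneg (hw m).1.le _)]
  have hweight : ∀ m, (w m ^ (2 / (p - 2))) ^ 2 * w m ^ 2 = w m ^ (2 * p / (p - 2)) := fun m => by
    rw [← Real.rpow_natCast (w m ^ _), ← Real.rpow_mul (hw m).1.le, ← Real.rpow_natCast (w m) 2,
      ← Real.rpow_add (hw m).1]
    congr 1
    push_cast
    field_simp
    ring
  set S := ∑ m ∈ F, w m ^ (2 * p / (p - 2)) with hSdef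
  have hXsq : XpNorm p w b ^ 2 = S := by
    have h1 : ∑' n, |b n| ^ p = S := by
      rw [tsum_eq_sum (s := F) fun m hm => by rw [hb0 m hm, abs_zero, Real.zero_rpow hp0.ne']]
      refine Finset.sum_congr rfl fun m hm => ?_
      rw [habs m hm, ← Real.rpow_mul (hw m).1.le]
      congr 1
      ring
    have h2 : ∑' n, b n ^ 2 * w n ^ 2 = S := by
      rw [tsum_eq_sum (s := F) fun m hm => by rw [hb0 m hm]; ring]
      refine Finset.sum_congr rfl fun m hm => ?_
      rw [← sq_abs, habs m hm, hweight]
    have hexp : S ^ (1 / p) ≤ S ^ (1 / 2 : ℝ) := by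
      gcongr
      exact hS.le
    rw [XpNorm, h1, h2, max_eq_right hexp, ← Real.sqrt_eq_rpow, Real.sq_sqrt (by linarith)]
  have hupper : ∫ x, T b x ^ 2 ∂ν ≤ C ^ 2 * S := by
    have h0 : 0 ≤ lpN ν p (T b) :=
      Real.rpow_nonneg (integral_nonneg fun x => by positivity) _
    rw [← hXsq, ← mul_pow]
    exact (integrable_sq_and_integral_sq_le hp (hint b)).2.trans (pow_le_pow_left₀ h0 (hC b) 2)
  have hlower : C ^ 2 * S < ∑ m ∈ F, ∫ x, T (Finsupp.single m (w m ^ (2 / (p - 2)))) x ^ 2 ∂ν := by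
    rw [hSdef, Finset.mul_sum]
    refine Finset.sum_lt_sum_of_nonempty ?_ fun m hm => ?_
    · rw [Finset.nonempty_iff_ne_empty]
      rintro rfl
      simp at hSdef
      linarith
    · have hsingle : Finsupp.single m (w m ^ (2 / (p - 2))) =
          w m ^ (2 / (p - 2)) • Finsupp.single m (1 : ℝ) := by simp
      have hlt := pow_lt_pow_left₀ (hF m hm) (mul_nonneg hCpos.le (hw m).1.le) two_ne_zero
      rw [lpN_two_sq, mul_pow] at hlt
      simp only [hsingle, map_smul, Pi.smul_apply, smul_eq_mul, mul_pow]
      rw [integral_const_mul, ← hweight]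
      have hpos : 0 < (w m ^ (2 / (p - 2))) ^ 2 := pow_pos (Real.rpow_pos_of_pos (hw m).1 _) 2
      calc _ = (w m ^ (2 / (p - 2))) ^ 2 * (C ^ 2 * w m ^ 2) := by ring
        _ < _ := by gcongr
  exact absurd (hlower.trans_le (hle.trans hupper)) (lt_irrefl _)
end

section
/- Let 2 < p < ∞ and r ≥ 2. Given a sequence (ε_i) of positive reals, constants C, D, w_0 > 0, and K ∈ ℕ, there exists an integer N_0 with the following property: whenever (w_n)_{n=1}^{N_0} are weights with w_0 ≤ w_n ≤ 1, Z is a Banach space with a basic sequence (z_n) whose biorthogonal functionals (z_n^*) have norm 1 and which satisfies a lower ℓ_r-estimate with constant C (‖∑ a_n z_n‖ ≥ C (∑ |a_n|^r)^{1/r}), and T is a linear operator from the finite-dimensional space X_{p,(w_n)_{n=1}^{N_0}} into Z with ‖T‖ ≤ D, then there exist distinct indices n_1, …, n_K in {1, …, N_0} such that for all 1 ≤ i < j ≤ K: |z_{n_i}^*(T x_{n_j})| < ε_j w_{n_j}/(j−1) and |z_{n_j}^*(T x_{n_i})| < ε_i w_{n_i}/(j−1). -/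
open Finset

/-- A finite digraph whose out-degrees are at most `M` and which has at least `(2 * M + 1) * K`
vertices contains an independent set of size `K`. -/
theorem exists_independent_of_outdegree_le {α : Type*} [DecidableEq α] (R : α → α → Prop)
    [DecidableRel R] (M K : ℕ) (S : Finset α) (hS : (2 * M + 1) * K ≤ #S)
    (hR : ∀ i ∈ S, #{j ∈ S | R i j} ≤ M) :
    ∃ A ⊆ S, #A = K ∧ ∀ i ∈ A, ∀ j ∈ A, i ≠ j → ¬ R i j := by
  induction K generalizing S with
  | zero => exact ⟨∅, by simp, by simp, by simp⟩
  | succ K ih =>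
    have hne : S.Nonempty := by
      rw [← Finset.card_pos]
      exact lt_of_lt_of_le (by positivity) hS
    obtain ⟨v, hvS, hv⟩ : ∃ v ∈ S, #{i ∈ S | R i v} ≤ M := by
      apply Finset.exists_le_of_sum_le hne
      have h := Finset.sum_card_bipartiteAbove_eq_sum_card_bipartiteBelow (s := S) (t := S) R
      simp only [Finset.bipartiteAbove, Finset.bipartiteBelow] at h
      rw [← h]
      exact Finset.sum_le_sum hR
    set B : Finset α := insert v ({i ∈ S | R i v} ∪ {j ∈ S | R v j}) with hB
    have hBcard : #B ≤ 2 * M + 1 := by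
      have h₁ := Finset.card_insert_le v ({i ∈ S | R i v} ∪ {j ∈ S | R v j})
      have h₂ := Finset.card_union_le {i ∈ S | R i v} {j ∈ S | R v j}
      have h₃ := hR v hvS
      rw [← hB] at h₁
      omega
    have hcard : (2 * M + 1) * K ≤ #(S \ B) := by
      have h := Finset.le_card_sdiff B S
      rw [mul_add, mul_one] at hS
      omega
    obtain ⟨A, hAS, hAK, hA⟩ := ih (S \ B) hcard fun i hi =>
      (Finset.card_le_card (Finset.filter_subset_filter _ Finset.sdiff_subset)).trans
        (hR i (Finset.mem_sdiff.1 hi).1)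
    have hnotin : ∀ i ∈ A, i ∈ S ∧ i ≠ v ∧ ¬ R i v ∧ ¬ R v i := by
      intro i hi
      have h := hAS hi
      simp only [hB, Finset.mem_sdiff, Finset.mem_insert, Finset.mem_union,
        Finset.mem_filter] at h
      tauto
    refine ⟨insert v A, Finset.insert_subset hvS fun i hi => (hnotin i hi).1, ?_, ?_⟩
    · rw [Finset.card_insert_of_notMem fun h => (hnotin v h).2.1 rfl, hAK]
    · intro i hi j hj hij
      rcases Finset.mem_insert.1 hi with rfl | hi'
      · rcases Finset.mem_insert.1 hj with rfl | hj'
        · exact absurd rfl hij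
        · exact (hnotin j hj').2.2.2
      · rcases Finset.mem_insert.1 hj with rfl | hj'
        · exact (hnotin i hi').2.2.1
        · exact hA i hi' j hj' hij

/-- For weights at most `1`, a vector supported in `A` with coordinates of modulus at most `1`
has `X_p`-norm at most `√#A`. -/
theorem XpNorm_le_sqrt_card {p : ℝ} (hp : 2 ≤ p) {w a : ℕ → ℝ} {A : Finset ℕ}
    (hw : ∀ n ∈ A, |w n| ≤ 1) (ha : ∀ n, |a n| ≤ 1) (ha' : ∀ n ∉ A, a n = 0) :
    XpNorm p w a ≤ √(#A) := by
  have hp0 : 0 < p := by linarith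
  have h₁ : ∑' n, |a n| ^ p ≤ #A := by
    rw [tsum_eq_sum (s := A) fun n hn => by simp [ha' n hn, hp0.ne']]
    calc ∑ n ∈ A, |a n| ^ p ≤ ∑ n ∈ A, (1 : ℝ) :=
          Finset.sum_le_sum fun n _ => Real.rpow_le_one (abs_nonneg _) (ha n) hp0.le
      _ = #A := by simp
  have h₂ : ∑' n, a n ^ 2 * w n ^ 2 ≤ #A := by
    rw [tsum_eq_sum (s := A) fun n hn => by simp [ha' n hn]]
    calc ∑ n ∈ A, a n ^ 2 * w n ^ 2 ≤ ∑ n ∈ A, (1 : ℝ) :=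
          Finset.sum_le_sum fun n hn => mul_le_one₀ ((sq_le_one_iff_abs_le_one _).2 (ha n))
            (sq_nonneg _) ((sq_le_one_iff_abs_le_one _).2 (hw n hn))
      _ = #A := by simp
  rw [Real.sqrt_eq_rpow]
  refine max_le ?_ (Real.rpow_le_rpow (tsum_nonneg fun n => by positivity) h₂ (by norm_num))
  refine (Real.rpow_le_rpow (tsum_nonneg fun n => by positivity) h₁ (by positivity)).trans ?_
  rcases Nat.eq_zero_or_pos #A with h0 | hpos
  · rw [h0, Nat.cast_zero, Real.zero_rpow (by positivity), Real.zero_rpow (by norm_num)]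
  · exact Real.rpow_le_rpow_of_exponent_le (by exact_mod_cast hpos)
      (one_div_le_one_div_of_le two_pos hp)

/-- A functional of norm at most `D` on `X_{p,(w_n)_{n<N}}` is at least `δ` in modulus on at most
`(D / δ) ^ 2` basis vectors. -/
theorem card_filter_le_abs_apply_single {p : ℝ} (hp : 2 ≤ p) {w : ℕ → ℝ} {N : ℕ}
    (hw : ∀ n < N, |w n| ≤ 1) {D δ : ℝ} (hD : 0 ≤ D) (hδ : 0 < δ) (f : (ℕ →₀ ℝ) →ₗ[ℝ] ℝ)
    (hf : ∀ a : ℕ →₀ ℝ, a.support ⊆ Finset.range N → |f a| ≤ D * XpNorm p w a) :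
    (#{n ∈ Finset.range N | δ ≤ |f (Finsupp.single n 1)|} : ℝ) ≤ (D / δ) ^ 2 := by
  classical
  set A : Finset ℕ := {n ∈ Finset.range N | δ ≤ |f (Finsupp.single n 1)|}
  let s : ℕ → ℝ := fun n => if n ∈ A then (SignType.sign (f (Finsupp.single n 1)) : ℝ) else 0
  have hs' : ∀ n ∉ A, s n = 0 := fun n hn => if_neg hn
  have hs : ∀ n, |s n| ≤ 1 := by
    intro n
    by_cases hn : n ∈ A
    · simp only [s, if_pos hn]
      rcases SignType.sign (f (Finsupp.single n 1)) with _ | _ | _ <;> simp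
    · simp [hs' n hn]
  let a : ℕ →₀ ℝ := Finsupp.onFinset A s fun n hn => by
    by_contra h
    exact hn (hs' n h)
  have hsupp : a.support ⊆ A := Finsupp.support_onFinset_subset
  have hnorm : XpNorm p w a ≤ √(#A) :=
    XpNorm_le_sqrt_card hp
      (fun n hn => hw n (Finset.mem_range.1 (Finset.mem_filter.1 hn).1)) hs hs'
  have hfa : f a = ∑ n ∈ A, |f (Finsupp.single n 1)| := by
    have h : a = ∑ n ∈ A, s n • Finsupp.single n (1 : ℝ) := by
      ext m
      simp only [Finsupp.coe_finsetSum, Finset.sum_apply, Finsupp.smul_apply, smul_eq_mul,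
        Finsupp.single_apply, mul_ite, mul_one, mul_zero, Finset.sum_ite_eq']
      by_cases hm : m ∈ A
      · rw [if_pos hm]; rfl
      · rw [if_neg hm]; exact hs' m hm
    rw [h, map_sum]
    refine Finset.sum_congr rfl fun n hn => ?_
    rw [map_smul, smul_eq_mul]
    simp only [s, if_pos hn]
    exact sign_mul_self _
  have hlow : δ * #A ≤ f a := by
    rw [hfa, mul_comm, ← nsmul_eq_mul]
    exact Finset.card_nsmul_le_sum _ _ _ fun n hn => (Finset.mem_filter.1 hn).2
  have hmain : δ * #A ≤ D * √(#A) :=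
    hlow.trans <| (le_abs_self _).trans <|
      (hf a (hsupp.trans (Finset.filter_subset _ _))).trans
        (mul_le_mul_of_nonneg_left hnorm hD)
  have hroot : √(#A) ≤ D / δ := by
    rw [le_div_iff₀ hδ]
    rcases (Real.sqrt_nonneg (#A : ℝ)).eq_or_lt with h0 | hpos
    · rw [← h0]; simpa using hD
    · refine le_of_mul_le_mul_right ?_ hpos
      have hsq := Real.mul_self_sqrt (Nat.cast_nonneg (α := ℝ) #A)
      calc √(#A) * δ * √(#A) = δ * (√(#A) * √(#A)) := by ring
        _ ≤ D * √(#A) := by rw [hsq]; exact hmain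
  calc (#A : ℝ) = √(#A) ^ 2 := (Real.sq_sqrt (Nat.cast_nonneg _)).symm
    _ ≤ (D / δ) ^ 2 := by gcongr

/-- Lemma 6.2: given `(ε_i)`, `C`, `D`, `w₀` and `K`, there is `N₀` such that for any weights
`w₀ ≤ w_n ≤ 1` (`n < N₀`), any basic sequence `(z_n)` with norm-one biorthogonal functionals
satisfying a lower `ℓ_r`-estimate with constant `C`, and any operator
`T : X_{p,(w_n)_{n<N₀}} → Z` with `‖T‖ ≤ D`, there are `K` indices `n_1 < ⋯ < n_K < N₀` with
`|z_{n_i}^*(T x_{n_j})| < ε_j w_{n_j}/(j-1)` and `|z_{n_j}^*(T x_{n_i})| < ε_i w_{n_i}/(j-1)`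
for `i < j`. -/
theorem lemma_6_2
    (p : ℝ) (hp : 2 < p) (r : ℝ) (hr : 2 ≤ r)
    (ε : ℕ → ℝ) (hε : ∀ i, 0 < ε i)
    (C D w₀ : ℝ) (hC : 0 < C) (hD : 0 < D) (hw₀ : 0 < w₀) (K : ℕ) :
    ∃ N₀ : ℕ,
      ∀ (w : ℕ → ℝ), (∀ n < N₀, w₀ ≤ w n ∧ w n ≤ 1) →
      ∀ (E : Type) (_ : NormedAddCommGroup E), ∀ _ : NormedSpace ℝ E,
      ∀ (z : ℕ → E) (zstar : ℕ → E →L[ℝ] ℝ),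
        (∀ i j, zstar i (z j) = if i = j then 1 else 0) →
        (∀ n, ‖zstar n‖ = 1) →
        (∀ b : ℕ →₀ ℝ,
          C * (∑ n ∈ b.support, |b n| ^ r) ^ (1 / r) ≤ ‖∑ n ∈ b.support, b n • z n‖) →
      ∀ T : (ℕ →₀ ℝ) →ₗ[ℝ] E,
        (∀ a : ℕ →₀ ℝ, (↑a.support ⊆ Finset.range N₀) → ‖T a‖ ≤ D * XpNorm p w a) →
        ∃ n : Fin K → ℕ, StrictMono n ∧ (∀ j, n j < N₀) ∧
          ∀ i j : Fin K, i < j →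
            |zstar (n i) (T (Finsupp.single (n j) 1))| < ε j * w (n j) / (j : ℕ) ∧
            |zstar (n j) (T (Finsupp.single (n i) 1))| < ε i * w (n i) / (j : ℕ) := by
  classical
  obtain ⟨η, hη, hηε⟩ : ∃ η > 0, ∀ i < K, η ≤ ε i := by
    have h : ∀ k : ℕ, ∃ η > 0, ∀ i < k, η ≤ ε i := by
      intro k
      induction k with
      | zero => exact ⟨1, one_pos, by simp⟩
      | succ k ih =>
        obtain ⟨η, hη, h⟩ := ih
        refine ⟨min η (ε k), lt_min hη (hε k), fun i hi => ?_⟩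
        rcases Nat.lt_succ_iff_lt_or_eq.1 hi with hi | rfl
        · exact (min_le_left _ _).trans (h i hi)
        · exact min_le_right _ _
    exact h K
  set δ : ℝ := η * w₀ / (K + 1) with hδdef
  have hδ : 0 < δ := by positivity
  set M : ℕ := ⌊(D / δ) ^ 2⌋₊
  refine ⟨(2 * M + 1) * K, ?_⟩
  intro w hw E _ _ z zstar _ hzstar _ T hT
  set N := (2 * M + 1) * K
  let R : ℕ → ℕ → Prop := fun i j => δ ≤ |zstar i (T (Finsupp.single j 1))|
  obtain ⟨A, hAS, hAK, hA⟩ := exists_independent_of_outdegree_le R M K (Finset.range N)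
    (by rw [Finset.card_range]) (by
      intro i _
      refine Nat.le_floor ?_
      refine card_filter_le_abs_apply_single hp.le (w := w) (fun n hn => ?_) hD.le hδ
        ((zstar i : E →ₗ[ℝ] ℝ) ∘ₗ T) fun a ha => ?_
      · rw [abs_of_nonneg (hw₀.le.trans (hw n hn).1)]
        exact (hw n hn).2
      · refine le_trans ?_ (hT a (by exact_mod_cast ha))
        simpa [hzstar i] using (zstar i).le_opNorm (T a))
  have hlt : ∀ n : Fin K → ℕ, (∀ j, n j < N) → ∀ i j k : Fin K, i < j →
      δ ≤ ε k * w (n k) / (j : ℕ) := by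
    intro n hn i j k hij
    have hj : (0 : ℝ) < (j : ℕ) := by
      exact_mod_cast (Nat.zero_le _).trans_lt (Fin.lt_def.1 hij)
    have hjK : ((j : ℕ) : ℝ) ≤ K + 1 := by
      exact_mod_cast j.2.le.trans (Nat.le_succ K)
    have hk := hηε k k.2
    have hwk := (hw (n k) (hn k)).1
    have hεk := (hε k).le
    have hwk₀ := hw₀.le.trans hwk
    rw [hδdef]
    gcongr
  have hmem : ∀ j, A.orderEmbOfFin hAK j ∈ A := A.orderEmbOfFin_mem hAK
  have hNlt : ∀ j, A.orderEmbOfFin hAK j < N := fun j => Finset.mem_range.1 (hAS (hmem j))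
  refine ⟨A.orderEmbOfFin hAK, (A.orderEmbOfFin hAK).strictMono, hNlt, fun i j hij => ?_⟩
  have hne := ((A.orderEmbOfFin hAK).strictMono hij).ne
  exact ⟨(not_le.1 (hA _ (hmem i) _ (hmem j) hne)).trans_le (hlt _ hNlt i j j hij),
    (not_le.1 (hA _ (hmem j) _ (hmem i) hne.symm)).trans_le (hlt _ hNlt i j i hij)⟩
end

section
/- Let G ⊆ ℕ×ℕ and suppose there exists an integer M such that for every A ⊆ ℕ of cardinality M and every infinite B ⊆ ℕ, both (A×B) ∩ G ≠ ∅ and (B×A) ∩ G ≠ ∅. Then there exist infinite subsets H, L ⊆ ℕ such that H×L ⊆ G. -/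
open Filter in
/-- If every `M`-element set of rows meets every infinite set of columns in `R`, then all but
finitely many rows of `R` belong to a given ultrafilter finer than the cofinite filter. -/
theorem eventually_cofinite_eventually_of_forall_card_eq {α β : Type*} (R : α → β → Prop) (M : ℕ)
    (U : Ultrafilter β) (hU : (U : Filter β) ≤ cofinite)
    (hR : ∀ A : Finset α, A.card = M → ∀ B : Set β, B.Infinite → ∃ a ∈ A, ∃ b ∈ B, R a b) :
    ∀ᶠ a in cofinite, ∀ᶠ b in U, R a b := by
  rw [eventually_cofinite]
  by_contra hinf
  obtain ⟨A, hA, hcard⟩ := Set.Infinite.exists_subset_card_eq hinf M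
  have hev : ∀ᶠ b in U, ∀ a ∈ A, ¬ R a b :=
    (eventually_all_finset A).2 fun a ha => Ultrafilter.eventually_not.2 (hA ha)
  have hB : {b | ∀ a ∈ A, ¬ R a b}.Infinite := frequently_cofinite_iff_infinite.1 <|
    hev.frequently.filter_mono hU
  obtain ⟨a, ha, b, hb, hab⟩ := hR A hcard _ hB
  exact hb a ha hab

open Filter in
/-- If, along an ultrafilter finer than `atTop`, almost every row and almost every column of `R`
is large, then `R` contains an infinite rectangle. -/
theorem exists_infinite_rectangle_of_eventually (R : ℕ → ℕ → Prop) (U : Ultrafilter ℕ)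
    (hU : (U : Filter ℕ) ≤ atTop) (hrow : ∀ᶠ a in U, ∀ᶠ b in U, R a b)
    (hcol : ∀ᶠ b in U, ∀ᶠ a in U, R a b) :
    ∃ H L : Set ℕ, H.Infinite ∧ L.Infinite ∧ ∀ h ∈ H, ∀ l ∈ L, R h l := by
  have hlt (n : ℕ) : ∀ᶠ m in U, n < m := hU (eventually_gt_atTop n)
  obtain ⟨f, hf, hfr⟩ := exists_seq_of_forall_finset_exists
    (fun x : ℕ × ℕ => (∀ᶠ b in U, R x.1 b) ∧ (∀ᶠ a in U, R a x.2) ∧ R x.1 x.2)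
    (fun x y => (x.1 < y.1 ∧ x.2 < y.2) ∧ R x.1 y.2 ∧ R y.1 x.2) (by
      intro s hs
      obtain ⟨h, hh, hsh⟩ := (hrow.and ((eventually_all_finset s).2 fun x hx =>
        (hlt x.1).and (hs x hx).2.1)).exists
      obtain ⟨l, ⟨hl, hhl⟩, hsl⟩ := ((hcol.and hh).and ((eventually_all_finset s).2 fun x hx =>
        (hlt x.2).and (hs x hx).1)).exists
      exact ⟨(h, l), ⟨hh, hl, hhl⟩, fun x hx =>
        ⟨⟨(hsh x hx).1, (hsl x hx).1⟩, (hsl x hx).2, (hsh x hx).2⟩⟩)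
  have hmono₁ : StrictMono fun n => (f n).1 := fun m n hmn => (hfr m n hmn).1.1
  have hmono₂ : StrictMono fun n => (f n).2 := fun m n hmn => (hfr m n hmn).1.2
  refine ⟨_, _, Set.infinite_range_of_injective hmono₁.injective,
    Set.infinite_range_of_injective hmono₂.injective, ?_⟩
  rintro _ ⟨m, rfl⟩ _ ⟨n, rfl⟩
  rcases lt_trichotomy m n with hmn | rfl | hnm
  · exact (hfr m n hmn).2.1
  · exact (hf m).2.2
  · exact (hfr n m hnm).2.2


/-- Lemma 8.1: if `G ⊆ ℕ × ℕ` and there is an integer `M` such that every product `A × B`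
with `|A| = M` and `B` infinite meets `G` in both orders, then there are infinite sets
`H, L ⊆ ℕ` with `H × L ⊆ G`. -/
theorem exists_infinite_rectangle
    (G : Set (ℕ × ℕ)) (M : ℕ)
    (hG : ∀ A : Finset ℕ, A.card = M → ∀ B : Set ℕ, B.Infinite →
      (∃ a ∈ A, ∃ b ∈ B, (a, b) ∈ G) ∧ (∃ b ∈ B, ∃ a ∈ A, (b, a) ∈ G)) :
    ∃ H L : Set ℕ, H.Infinite ∧ L.Infinite ∧ ∀ h ∈ H, ∀ l ∈ L, (h, l) ∈ G := by
  have hU : (Filter.hyperfilter ℕ : Filter ℕ) ≤ Filter.cofinite := Filter.hyperfilter_le_cofinite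
  refine exists_infinite_rectangle_of_eventually (fun a b => (a, b) ∈ G) (Filter.hyperfilter ℕ)
    (Nat.cofinite_eq_atTop ▸ hU) (hU ?_) (hU ?_)
  · exact eventually_cofinite_eventually_of_forall_card_eq _ M _ hU
      fun A hA B hB => (hG A hA B hB).1
  · refine eventually_cofinite_eventually_of_forall_card_eq (fun b a => (a, b) ∈ G) M _ hU
      fun A hA B hB => ?_
    obtain ⟨b, hb, a, ha, hab⟩ := (hG A hA B hB).2
    exact ⟨a, ha, b, hb, hab⟩
end

section
/- Let G ⊆ ℕ×(ℕ×ℕ) and let N ∈ ℕ. Then at least one of the following holds: (1) there exists a rich subset K ⊆ ℕ×ℕ such that for each (j,l) ∈ K there are at least N elements n ∈ ℕ with (n,j,l) ∉ G; (2) there exist an infinite subset M ⊆ ℕ and a rich subset K ⊆ ℕ×ℕ such that (n,j,l) ∈ G for every n ∈ M and every (j,l) ∈ K. -/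
/-- A subset `S ⊆ ℕ × ℕ` is rich if there is an infinite `M ⊆ ℕ` such that for every `m ∈ M`
the set `{k : (m,k) ∈ S}` is infinite. -/
def Rich (S : Set (ℕ × ℕ)) : Prop :=
  ∃ M : Set ℕ, M.Infinite ∧ ∀ m ∈ M, {k | (m, k) ∈ S}.Infinite

/-- Every finite colouring of `ℕ × ℕ` has a rich colour class. -/
theorem exists_rich_fiber {α : Type*} [Finite α] (c : ℕ × ℕ → α) :
    ∃ a, Rich (c ⁻¹' {a}) := by
  have row (m : ℕ) : ∃ a, {k | c (m, k) = a}.Infinite := by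
    obtain ⟨a, ha⟩ := Finite.exists_infinite_fiber fun k => c (m, k)
    exact ⟨a, Set.infinite_coe_iff.mp ha⟩
  choose d hd using row
  obtain ⟨a, ha⟩ := Finite.exists_infinite_fiber d
  refine ⟨a, d ⁻¹' {a}, Set.infinite_coe_iff.mp ha, ?_⟩
  rintro m rfl
  exact hd m

/-- A set with fewer than `N` elements misses some residue class modulo `N`. -/
theorem exists_finset_card_or_exists_residue (P : ℕ → Prop) (N : ℕ) :
    (∃ F : Finset ℕ, N ≤ F.card ∧ ∀ n ∈ F, ¬ P n) ∨ ∃ i : Fin N, ∀ n, n % N = i → P n := by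
  by_contra! h
  obtain ⟨hF, hi⟩ := h
  choose f hf hfP using hi
  have inj : Function.Injective f := fun i j hij => by
    apply Fin.ext
    rw [← hf i, ← hf j, hij]
  obtain ⟨n, hn, hP⟩ := hF (Finset.univ.map ⟨f, inj⟩) (by simp)
  obtain ⟨i, -, rfl⟩ := Finset.mem_map.mp hn
  exact hfP i hP

/-- Lemma 8.2: for `G ⊆ ℕ × (ℕ × ℕ)` and `N ∈ ℕ`, either (1) there is a rich `K ⊆ ℕ × ℕ` such
that for each `(j,l) ∈ K` there are at least `N` elements `n` with `(n,j,l) ∉ G`, or (2) there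
are an infinite `M ⊆ ℕ` and a rich `K ⊆ ℕ × ℕ` with `(n,j,l) ∈ G` for all `n ∈ M`,
`(j,l) ∈ K`. -/
theorem rich_dichotomy (G : Set (ℕ × ℕ × ℕ)) (N : ℕ) :
    (∃ K : Set (ℕ × ℕ), Rich K ∧
      ∀ jl ∈ K, ∃ F : Finset ℕ, N ≤ F.card ∧ ∀ n ∈ F, (n, jl.1, jl.2) ∉ G) ∨
    (∃ (M : Set ℕ) (K : Set (ℕ × ℕ)), M.Infinite ∧ Rich K ∧
      ∀ n ∈ M, ∀ jl ∈ K, (n, jl.1, jl.2) ∈ G) := by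
  have colour (p : ℕ × ℕ) : ∃ o : Option (Fin N),
      (o = none → ∃ F : Finset ℕ, N ≤ F.card ∧ ∀ n ∈ F, (n, p.1, p.2) ∉ G) ∧
      ∀ i, o = some i → ∀ n, n % N = i → (n, p.1, p.2) ∈ G := by
    rcases exists_finset_card_or_exists_residue (fun n => (n, p.1, p.2) ∈ G) N with h | ⟨i, hi⟩
    · exact ⟨none, fun _ => h, by simp⟩
    · refine ⟨some i, by simp, fun j hj => ?_⟩
      obtain rfl := Option.some.inj hj
      exact hi
  choose c hnone hsome using colour
  obtain ⟨_ | i, hK⟩ := exists_rich_fiber c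
  · exact Or.inl ⟨_, hK, fun p hp => hnone p hp⟩
  · refine Or.inr ⟨{n | n % N = i}, _, ?_, hK, fun n hn p hp => hsome p i hp n hn⟩
    refine Set.infinite_of_injective_forall_mem (f := fun k => N * k + i) (fun a b hab => ?_)
      fun k => ?_
    · exact Nat.eq_of_mul_eq_mul_left i.pos (Nat.add_right_cancel hab)
    · simp [Nat.mod_eq_of_lt i.isLt]
end
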